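/- With G, n, t, k and the labeling v_1, …, v_n as in the setup: k ≥ n/2 − t. -/

import Mathlib

/-- A graph `G` is `t`-tough if `|S| ≥ t · c(G − S)` for every vertex subset `S`
whose removal leaves at least two connected components. -/
def SimpleGraph.Tough {V : Type*} [Fintype V] (t : ℚ) (G : SimpleGraph V) : Prop :=
  ∀ S : Finset V,
    2 ≤ Nat.card ((G.induce ((↑S : Set V)ᶜ)).ConnectedComponent) →
    t * (Nat.card ((G.induce ((↑S : Set V)ᶜ)).ConnectedComponent) : ℚ) ≤ (S.card : ℚ)

namespace SimpleGraph

variable {V : Type*} [Fintype V] [DecidableEq V] (G : SimpleGraph V) [DecidableRel G.Adj]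

/-- A vertex of degree `|V| - 1` is adjacent to every other vertex. -/
theorem adj_of_card_le_degree_succ {a b : V} (ha : Fintype.card V ≤ G.degree a + 1)
    (hab : a ≠ b) : G.Adj a b := by
  by_contra hadj
  have hpos : 0 < Gᶜ.degree a :=
    (Gᶜ.degree_pos_iff_exists_adj a).2 ⟨b, (G.compl_adj a b).2 ⟨hab, hadj⟩⟩
  rw [G.degree_compl] at hpos
  omega

/-- If the vertices labeled `m, …, n` are all universal, then every vertex that is not universal
has degree at least `n - m + 1`. -/
theorem sub_lt_degree_of_universal {n m : ℕ} {v : ℕ → V} (hn : Fintype.card V = n)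
    (hinj : Set.InjOn v (Set.Icc 1 n)) (hm : 1 ≤ m)
    (huniv : ∀ j, m ≤ j → j ≤ n → n ≤ G.degree (v j) + 1)
    {x : V} (hx : G.degree x + 1 < n) : n + 1 - m ≤ G.degree x := by
  have hcard : ((Finset.Icc m n).image v).card = n + 1 - m := by
    rw [Finset.card_image_of_injOn, Nat.card_Icc]
    exact hinj.mono fun j hj => by
      rw [Finset.mem_coe, Finset.mem_Icc] at hj
      exact ⟨hm.trans hj.1, hj.2⟩
  rw [← hcard, ← G.card_neighborFinset_eq_degree]
  refine Finset.card_le_card fun y hy => ?_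
  obtain ⟨j, hj, rfl⟩ := Finset.mem_image.1 hy
  rw [Finset.mem_Icc] at hj
  have hdeg := huniv j hj.1 hj.2
  rw [mem_neighborFinset]
  refine (G.adj_of_card_le_degree_succ (hn.trans_le hdeg) ?_).symm
  rintro rfl
  omega

/-- If at least `r` vertices have degree at most `c`, then so does the `r`-th vertex in the
degree ordering. -/
theorem degree_le_of_le_card {n r c : ℕ} {v : ℕ → V}
    (hsurj : Set.SurjOn v (Set.Icc 1 n) Set.univ)
    (hmono : ∀ i j, 1 ≤ i → i ≤ j → j ≤ n → G.degree (v i) ≤ G.degree (v j))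
    (hr : 1 ≤ r) (s : Finset V) (hs : ∀ x ∈ s, G.degree x ≤ c) (hrs : r ≤ s.card) :
    G.degree (v r) ≤ c := by
  by_contra! hlt
  have hsub : s ⊆ (Finset.Ico 1 r).image v := fun x hx => by
    obtain ⟨j, hj, rfl⟩ := hsurj (Set.mem_univ x)
    refine Finset.mem_image_of_mem v (Finset.mem_Ico.2 ⟨hj.1, ?_⟩)
    by_contra! hrj
    have := hmono r j hr hrj hj.2
    have := hs _ hx
    omega
  have hle := (Finset.card_le_card hsub).trans Finset.card_image_le
  rw [Nat.card_Ico] at hle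
  omega

end SimpleGraph

/-- With the full setup (non-Hamiltonian `t`-closed `t`-tough graph, degree
condition, `k` minimal with `d_k ≤ k`, `k < n/2`): `k ≥ n/2 − t`. -/
theorem k_ge_half_n_sub_t
    {V : Type*} [Fintype V] [DecidableEq V] (G : SimpleGraph V) [DecidableRel G.Adj]
    (n t : ℕ) (ht : 4 ≤ t) (hn : Fintype.card V = n) (hn3 : 3 ≤ n)
    (htough : SimpleGraph.Tough (t : ℚ) G) (hnotham : ¬ G.IsHamiltonian)
    (v : ℕ → V) (hbij : Set.BijOn v (Set.Icc 1 n) Set.univ)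
    (hmono : ∀ i j, 1 ≤ i → i ≤ j → j ≤ n → G.degree (v i) ≤ G.degree (v j))
    (hcond : ∀ i, 1 ≤ i → 2 * i < n →
      G.degree (v i) ≤ i → n - i ≤ G.degree (v (n - i + t)))
    (hclosed : ∀ a b : V, a ≠ b → ¬ G.Adj a b →
      (G.degree a : ℤ) + (G.degree b : ℤ) < (n : ℤ) - (t : ℤ))
    (k : ℕ) (hk1 : 1 ≤ k) (hk2 : 2 * k < n) (hkd : G.degree (v k) ≤ k)
    (hkmin : ∀ i, 1 ≤ i → 2 * i < n → G.degree (v i) ≤ i → k ≤ i) :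
    (n : ℚ) / 2 - (t : ℚ) ≤ (k : ℚ) := by
  have hvk : G.degree (v k) + 1 < n := by omega
  obtain ⟨w, hw, hwmax⟩ := Finset.exists_max_image
    (Finset.univ.filter fun x => G.degree x + 1 < n) (fun x => G.degree x)
    ⟨v k, by simpa using hvk⟩
  replace hw : G.degree w + 1 < n := by simpa using hw
  replace hwmax : ∀ x, G.degree x + 1 < n → G.degree x ≤ G.degree w := fun x hx =>
    hwmax x (by simpa using hx)
  have huniv : ∀ m, 1 ≤ m → G.degree w < G.degree (v m) →
      ∀ j, m ≤ j → j ≤ n → n ≤ G.degree (v j) + 1 := fun m hm hlt j hmj hjn => by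
    by_contra! hj
    have := hwmax _ hj
    have := hmono m j hm hmj hjn
    omega
  have hnear : ∀ x ∈ Gᶜ.neighborFinset w, G.degree w + G.degree x + t + 1 ≤ n := fun x hx => by
    rw [SimpleGraph.mem_neighborFinset, SimpleGraph.compl_adj] at hx
    have := hclosed w x hx.1 hx.2
    omega
  obtain ⟨r, hr⟩ : ∃ r, r = n - 1 - G.degree w := ⟨_, rfl⟩
  have hrcard : (Gᶜ.neighborFinset w).card = r := by
    rw [SimpleGraph.card_neighborFinset_eq_degree, G.degree_compl, hn, hr]
  rcases lt_or_ge (2 * r) n with h2r | h2r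
  · exfalso
    obtain ⟨y, hy⟩ := Finset.card_pos.1 (show 0 < (Gᶜ.neighborFinset w).card by omega)
    have hynear := hnear y hy
    have hdr : G.degree (v r) ≤ r - t :=
      G.degree_le_of_le_card hbij.surjOn hmono (by omega) (Gᶜ.neighborFinset w)
        (fun x hx => by have := hnear x hx; omega) hrcard.ge
    have hhigh := hcond r (by omega) h2r (by omega)
    have := G.sub_lt_degree_of_universal hn hbij.injOn (by omega)
      (huniv (n - r + t) (by omega) (by omega)) (x := v r) (by omega)
    omega
  · obtain ⟨i, hi⟩ : ∃ i, i = (n - 1) / 2 := ⟨_, rfl⟩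
    suffices hgoal : n ≤ 2 * (k + t) by
      have : (n : ℚ) ≤ 2 * (k + t) := by exact_mod_cast hgoal
      linarith
    by_contra! hlt
    have hdi : G.degree (v i) ≤ i := by
      by_contra! hdi
      have := G.sub_lt_degree_of_universal hn hbij.injOn (by omega)
        (huniv i (by omega) (by omega)) hvk
      omega
    have hhigh := hcond i (by omega) (by omega) hdi
    have := G.sub_lt_degree_of_universal hn hbij.injOn (by omega)
      (huniv (n - i + t) (by omega) (by omega)) hvk
    omega
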